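/- arXiv:1311.2298 — 2 statements merged into one kernel-verified Lean document; each statement's English description precedes it below -/
import Mathlib

section
/- Suppose that ℬ is a finite family of finite sets in 𝒫(n) with |ℬ| = m. Then ‖ℬ‖ ≤ ‖I(m)‖ + def(ℬ). -/
open Finset
open scoped Classical

/-- The total size `‖𝒜‖ = Σ_{A∈𝒜} |A|` of a family of finite sets. -/
def totalSize (𝒜 : Finset (Finset ℕ)) : ℕ := ∑ A ∈ 𝒜, A.card

/-- A family is union-closed if it is closed under pairwise unions. -/
def UnionClosed (𝒜 : Finset (Finset ℕ)) : Prop := ∀ A ∈ 𝒜, ∀ B ∈ 𝒜, A ∪ B ∈ 𝒜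

/-- The `k`-th finite set of positive integers in the colex order: the positive
integer `i` belongs to it iff bit `i - 1` of `k` is set. -/
def colexSet (k : ℕ) : Finset ℕ :=
  ((Finset.range (k + 1)).filter fun i => k.testBit i).image (· + 1)

/-- The initial segment `I(m)` of length `m` of the colex order on finite sets
of positive integers. -/
def colexInit (m : ℕ) : Finset (Finset ℕ) := (Finset.range m).image colexSet

/-- A family `ℬ` is simply rooted if every nonempty `B ∈ ℬ` has some `b ∈ B`
with the whole cube `[{b}, B]` contained in `ℬ`. -/
def SimplyRooted (ℬ : Finset (Finset ℕ)) : Prop :=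
  ∀ B ∈ ℬ, B.Nonempty → ∃ b ∈ B, ∀ C : Finset ℕ, {b} ⊆ C → C ⊆ B → C ∈ ℬ

/-- `B` is `ℬ`-rooted at `i`: `i ∈ B` and the cube `[{i}, B]` lies in `ℬ`. -/
def RootedAt (ℬ : Finset (Finset ℕ)) (B : Finset ℕ) (i : ℕ) : Prop :=
  i ∈ B ∧ ∀ C : Finset ℕ, {i} ⊆ C → C ⊆ B → C ∈ ℬ

/-- `ℬ_S`: the sets of `ℬ` that are `ℬ`-rooted at some element of `S`. -/
noncomputable def rootedFam (ℬ : Finset (Finset ℕ)) (S : Finset ℕ) : Finset (Finset ℕ) :=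
  ℬ.filter fun B => ∃ i ∈ S, RootedAt ℬ B i

/-- The image of a single set `B` under the down-compression of `ℬ` in
direction `i`. -/
def compressSet (ℬ : Finset (Finset ℕ)) (i : ℕ) (B : Finset ℕ) : Finset ℕ :=
  if i ∈ B ∧ B.erase i ∉ ℬ then B.erase i else B

/-- The down-compression `d_i(ℬ)` of the family `ℬ` in direction `i`. -/
def dComp (i : ℕ) (ℬ : Finset (Finset ℕ)) : Finset (Finset ℕ) :=
  ℬ.image (compressSet ℬ i)

/-- `D_k(ℬ) = d_k(⋯ d_1(ℬ) ⋯)`.  In particular `d(ℬ) = D_n(ℬ)` for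
`ℬ ⊆ 𝒫(n)`. -/
def DComp : ℕ → Finset (Finset ℕ) → Finset (Finset ℕ)
  | 0, ℬ => ℬ
  | k + 1, ℬ => dComp (k + 1) (DComp k ℬ)

/-- `D_{(ℬ,k)}(B)`: the image of the set `B` obtained by following `B` through
the successive compressions `d_1, …, d_k`.  In particular `d_ℬ(B) = D_{(ℬ,n)}(B)`
for `ℬ ⊆ 𝒫(n)`. -/
def DCompSet : ℕ → Finset (Finset ℕ) → Finset ℕ → Finset ℕ
  | 0, _, B => B
  | k + 1, ℬ, B => compressSet (DComp k ℬ) (k + 1) (DCompSet k ℬ B)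

/-- The shadow `δB = {B \ {i} : i ∈ B}` of a finite set `B`. -/
def shadowSet (B : Finset ℕ) : Finset (Finset ℕ) := B.image fun i => B.erase i

/-- `B` is a bad set of `ℬ ⊆ 𝒫(n)` if `δB ⊆ ℬ` or `d_ℬ(B) = B`. -/
def BadSet (n : ℕ) (ℬ : Finset (Finset ℕ)) (B : Finset ℕ) : Prop :=
  shadowSet B ⊆ ℬ ∨ DCompSet n ℬ B = B

/-- A family is a down-set if it is closed under taking subsets. -/
def IsDownSet (𝒟 : Finset (Finset ℕ)) : Prop := ∀ A ∈ 𝒟, ∀ B ⊆ A, B ∈ 𝒟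

/-- The deficiency `def(ℬ) = Σ_{B∈ℬ} |δB \ ℬ|`. -/
def deficiency (ℬ : Finset (Finset ℕ)) : ℕ := ∑ B ∈ ℬ, (shadowSet B \ ℬ).card

/-- `𝒜 ⊆ 𝒫(n)` is a counterexample to the union-closed conjecture:
union-closed, not `{∅}`, and every element of `[n]` has degree `< |𝒜|/2`. -/
def UCCounterexample (n : ℕ) (𝒜 : Finset (Finset ℕ)) : Prop :=
  𝒜 ⊆ (Finset.Icc 1 n).powerset ∧ UnionClosed 𝒜 ∧ 𝒜 ≠ {∅} ∧
    ∀ i ∈ Finset.Icc 1 n, ((𝒜.filter fun A => i ∈ A).card : ℚ) < (𝒜.card : ℚ) / 2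

theorem succ_mem_colexSet {k i : ℕ} : i + 1 ∈ colexSet k ↔ k.testBit i = true := by
  simp only [colexSet, mem_image, mem_filter, mem_range, Nat.add_right_cancel_iff]
  constructor
  · rintro ⟨j, ⟨-, hj⟩, rfl⟩
    exact hj
  · intro h
    have h₁ := Nat.ge_two_pow_of_testBit h
    have h₂ : i < 2 ^ i := Nat.lt_two_pow_self
    exact ⟨i, ⟨by omega, h⟩, rfl⟩

theorem zero_notMem_colexSet (k : ℕ) : 0 ∉ colexSet k := by
  simp [colexSet]

theorem colexSet_injective : Function.Injective colexSet := by
  intro a b h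
  refine Nat.eq_of_testBit_eq fun i => ?_
  rw [Bool.eq_iff_iff, ← succ_mem_colexSet, ← succ_mem_colexSet, h]

theorem card_colexSet_two_mul (k : ℕ) : (colexSet (2 * k)).card = (colexSet k).card := by
  have h : colexSet (2 * k) = (colexSet k).image (· + 1) := by
    ext i
    rcases i with _ | _ | i
    · simp [zero_notMem_colexSet]
    · simp [succ_mem_colexSet, zero_notMem_colexSet]
    · simp [succ_mem_colexSet, Nat.testBit_succ]
  rw [h, card_image_of_injective _ (add_left_injective 1)]

theorem card_colexSet_two_mul_add_one (k : ℕ) :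
    (colexSet (2 * k + 1)).card = (colexSet k).card + 1 := by
  have h : colexSet (2 * k + 1) = insert 1 ((colexSet k).image (· + 1)) := by
    ext i
    rcases i with _ | _ | i
    · simp [zero_notMem_colexSet]
    · simp [succ_mem_colexSet]
    · have h₁ : (2 * k + 1) / 2 = k := by omega
      simp [succ_mem_colexSet, Nat.testBit_succ, h₁]
  rw [h, card_insert_of_notMem (by simp [zero_notMem_colexSet]),
    card_image_of_injective _ (add_left_injective 1)]

theorem totalSize_colexInit_zero : totalSize (colexInit 0) = 0 := by
  simp [totalSize, colexInit]

theorem totalSize_colexInit_succ (m : ℕ) :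
    totalSize (colexInit (m + 1)) = totalSize (colexInit m) + (colexSet m).card := by
  simp only [totalSize, colexInit, sum_image colexSet_injective.injOn, sum_range_succ]

theorem totalSize_colexInit_two_mul (m : ℕ) :
    totalSize (colexInit (2 * m)) = 2 * totalSize (colexInit m) + m := by
  induction m with
  | zero => simp [totalSize_colexInit_zero]
  | succ m ih =>
    rw [show 2 * (m + 1) = 2 * m + 1 + 1 by ring, totalSize_colexInit_succ,
      totalSize_colexInit_succ, totalSize_colexInit_succ, ih, card_colexSet_two_mul,
      card_colexSet_two_mul_add_one]
    ring

theorem totalSize_colexInit_two_mul_add_one (m : ℕ) :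
    totalSize (colexInit (2 * m + 1)) =
      totalSize (colexInit m) + totalSize (colexInit (m + 1)) + m := by
  rw [totalSize_colexInit_succ, totalSize_colexInit_succ, totalSize_colexInit_two_mul,
    card_colexSet_two_mul]
  ring

theorem totalSize_colexInit_add_le {a b : ℕ} (hab : b ≤ a) :
    totalSize (colexInit a) + totalSize (colexInit b) + b ≤ totalSize (colexInit (a + b)) := by
  induction hs : a + b using Nat.strong_induction_on generalizing a b with
  | _ s ih =>
  subst hs
  rcases Nat.eq_zero_or_pos b with rfl | hb
  · simp [totalSize_colexInit_zero]
  obtain ⟨x, rfl | rfl⟩ := Nat.even_or_odd' a <;> obtain ⟨y, rfl | rfl⟩ := Nat.even_or_odd' b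
  · have h := ih (x + y) (by omega) (a := x) (b := y) (by omega) rfl
    rw [← mul_add]
    simp only [totalSize_colexInit_two_mul]
    omega
  · have h₁ := ih (x + y) (by omega) (a := x) (b := y) (by omega) rfl
    have h₂ := ih (x + y + 1) (by omega) (a := x) (b := y + 1) (by omega) rfl
    rw [show 2 * x + (2 * y + 1) = 2 * (x + y) + 1 by ring]
    simp only [totalSize_colexInit_two_mul, totalSize_colexInit_two_mul_add_one]
    omega
  · have h₁ := ih (x + y) (by omega) (a := x) (b := y) (by omega) rfl
    have h₂ := ih (x + y + 1) (by omega) (a := x + 1) (b := y) (by omega) (by ring)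
    rw [show 2 * x + 1 + 2 * y = 2 * (x + y) + 1 by ring]
    simp only [totalSize_colexInit_two_mul, totalSize_colexInit_two_mul_add_one]
    omega
  · rw [show 2 * x + 1 + (2 * y + 1) = 2 * (x + y + 1) by ring]
    simp only [totalSize_colexInit_two_mul, totalSize_colexInit_two_mul_add_one]
    have h₁ := ih (x + y + 1) (by omega) (a := x + 1) (b := y) (by omega) (by ring)
    rcases (show y ≤ x by omega).eq_or_lt with rfl | hxy
    · omega
    · have h₂ := ih (x + y + 1) (by omega) (a := x) (b := y + 1) (by omega) rfl
      omega

/-- The number of edges of the hypercube spanned by `ℬ`. -/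
def edgeCount (ℬ : Finset (Finset ℕ)) : ℕ := ∑ B ∈ ℬ, (B.filter fun i => B.erase i ∈ ℬ).card

theorem totalSize_eq_edgeCount_add_deficiency (ℬ : Finset (Finset ℕ)) :
    totalSize ℬ = edgeCount ℬ + deficiency ℬ := by
  rw [totalSize, edgeCount, deficiency, ← sum_add_distrib]
  refine sum_congr rfl fun B _ => ?_
  have h : shadowSet B \ ℬ = (B.filter fun i => B.erase i ∉ ℬ).image fun i => B.erase i := by
    ext C
    simp only [shadowSet, mem_sdiff, mem_image, mem_filter]
    constructor
    · rintro ⟨⟨i, hi, rfl⟩, hC⟩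
      exact ⟨i, ⟨hi, hC⟩, rfl⟩
    · rintro ⟨i, ⟨hi, hC⟩, rfl⟩
      exact ⟨⟨i, hi, rfl⟩, hC⟩
  rw [h, card_image_of_injOn, card_filter_add_card_filter_not]
  exact (erase_injOn B).mono (filter_subset _ B)

theorem edgeCount_eq_subfamilies (a : ℕ) (ℬ : Finset (Finset ℕ)) :
    edgeCount ℬ = edgeCount (ℬ.nonMemberSubfamily a) + edgeCount (ℬ.memberSubfamily a) +
      (ℬ.memberSubfamily a ∩ ℬ.nonMemberSubfamily a).card := by
  have hinj : Set.InjOn (insert a) (ℬ.memberSubfamily a : Set (Finset ℕ)) := by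
    intro B hB C hC h
    rw [mem_coe, mem_memberSubfamily] at hB hC
    rw [← erase_insert hB.2, h, erase_insert hC.2]
  have hmem : ℬ.filter (a ∈ ·) = (ℬ.memberSubfamily a).image (insert a) := by
    ext B
    simp only [mem_filter, mem_image, mem_memberSubfamily]
    constructor
    · rintro ⟨hB, ha⟩
      exact ⟨B.erase a, ⟨by rwa [insert_erase ha], notMem_erase a B⟩, insert_erase ha⟩
    · rintro ⟨C, ⟨hC, -⟩, rfl⟩
      exact ⟨hC, mem_insert_self a C⟩
  have hnon : ∑ B ∈ ℬ.filter (a ∉ ·), (B.filter fun i => B.erase i ∈ ℬ).card =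
      edgeCount (ℬ.nonMemberSubfamily a) := by
    refine sum_congr rfl fun B hB => ?_
    have ha := (mem_filter.1 hB).2
    congr 1
    refine filter_congr fun i _ => ?_
    simp [mem_nonMemberSubfamily, ha]
  have hin : ∑ B ∈ ℬ.filter (a ∈ ·), (B.filter fun i => B.erase i ∈ ℬ).card =
      edgeCount (ℬ.memberSubfamily a) +
        (ℬ.memberSubfamily a ∩ ℬ.nonMemberSubfamily a).card := by
    rw [hmem, sum_image hinj, ← filter_mem_eq_inter, card_filter, edgeCount, ← sum_add_distrib]
    refine sum_congr rfl fun B hB => ?_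
    have ha := (mem_memberSubfamily.1 hB).2
    have hrest : (B.filter fun i => (insert a B).erase i ∈ ℬ) =
        B.filter fun i => B.erase i ∈ ℬ.memberSubfamily a := by
      refine filter_congr fun i hi => ?_
      have hne : a ≠ i := fun h => ha (h ▸ hi)
      simp [mem_memberSubfamily, ha, erase_insert_of_ne hne]
    rw [filter_insert, hrest, erase_insert ha]
    by_cases hB' : B ∈ ℬ
    · simp [mem_nonMemberSubfamily, hB', ha]
    · simp [mem_nonMemberSubfamily, hB']
  rw [← hnon, add_assoc, ← hin, add_comm]
  exact (sum_filter_add_sum_filter_not ℬ (a ∈ ·) _).symm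

/-- The edge-isoperimetric inequality in the hypercube. -/
theorem edgeCount_le_totalSize_colexInit (S : Finset ℕ) {ℬ : Finset (Finset ℕ)}
    (hsub : ℬ ⊆ S.powerset) : edgeCount ℬ ≤ totalSize (colexInit ℬ.card) := by
  induction S using Finset.induction_on generalizing ℬ with
  | empty =>
    have h : edgeCount ℬ = 0 := by
      refine sum_eq_zero fun B hB => ?_
      have hB' : B = ∅ := by simpa using hsub hB
      simp [hB']
    omega
  | insert a S _ ih =>
    have h₀ : edgeCount (ℬ.nonMemberSubfamily a) ≤ _ := ih fun B hB => by
      rw [mem_nonMemberSubfamily] at hB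
      exact mem_powerset.2 ((subset_insert_iff_of_notMem hB.2).1 (mem_powerset.1 (hsub hB.1)))
    have h₁ : edgeCount (ℬ.memberSubfamily a) ≤ _ := ih fun B hB => by
      rw [mem_memberSubfamily] at hB
      exact mem_powerset.2 ((insert_subset_insert_iff hB.2).1 (mem_powerset.1 (hsub hB.1)))
    have hl := card_le_card
      (inter_subset_left (s₁ := ℬ.memberSubfamily a) (s₂ := ℬ.nonMemberSubfamily a))
    have hr := card_le_card
      (inter_subset_right (s₁ := ℬ.memberSubfamily a) (s₂ := ℬ.nonMemberSubfamily a))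
    rw [edgeCount_eq_subfamilies a, ← card_memberSubfamily_add_card_nonMemberSubfamily a ℬ]
    rcases le_total (ℬ.memberSubfamily a).card (ℬ.nonMemberSubfamily a).card with h | h
    · have := totalSize_colexInit_add_le h
      rw [add_comm (ℬ.memberSubfamily a).card]
      omega
    · have := totalSize_colexInit_add_le h
      omega

/-- For any family `ℬ ⊆ 𝒫(n)` with `|ℬ| = m`,
`‖ℬ‖ ≤ ‖I(m)‖ + def(ℬ)`. -/
theorem stmt11 (n : ℕ) (ℬ : Finset (Finset ℕ)) (hsub : ℬ ⊆ (Finset.Icc 1 n).powerset)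
    (m : ℕ) (hm : m = ℬ.card) :
    totalSize ℬ ≤ totalSize (colexInit m) + deficiency ℬ := by
  rw [hm, totalSize_eq_edgeCount_add_deficiency]
  exact Nat.add_le_add_right (edgeCount_le_totalSize_colexInit _ hsub) _
end

section
/- Let ℬ' ⊆ ℬ ⊆ 𝒫(n) be simply rooted families, and let B ∈ ℬ' be a good set of ℬ. Then d_ℬ(B) = d_{ℬ'}(B). -/
open Finset
open scoped Classical

theorem mem_dComp {i : ℕ} {ℱ : Finset (Finset ℕ)} {X : Finset ℕ} :
    X ∈ dComp i ℱ ↔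
      (i ∈ X ∧ X ∈ ℱ ∧ X.erase i ∈ ℱ) ∨ (i ∉ X ∧ (X ∈ ℱ ∨ insert i X ∈ ℱ)) := by
  simp only [dComp, mem_image, compressSet]
  constructor
  · rintro ⟨A, hA, rfl⟩
    split_ifs with h
    · exact Or.inr ⟨notMem_erase _ _, Or.inr (by rwa [insert_erase h.1])⟩
    · by_cases hi : i ∈ A
      · exact Or.inl ⟨hi, hA, by_contra fun h' => h ⟨hi, h'⟩⟩
      · exact Or.inr ⟨hi, Or.inl hA⟩
  · rintro (⟨_, hX, hXi⟩ | ⟨hi, h⟩)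
    · exact ⟨X, hX, if_neg fun h => h.2 hXi⟩
    · by_cases hX : X ∈ ℱ
      · exact ⟨X, hX, if_neg fun h => hi h.1⟩
      · have hins := h.resolve_left hX
        refine ⟨insert i X, hins, ?_⟩
        rw [erase_insert hi, if_pos ⟨mem_insert_self _ _, hX⟩]

theorem dComp_mono (i : ℕ) {ℱ 𝒢 : Finset (Finset ℕ)} (h : ℱ ⊆ 𝒢) : dComp i ℱ ⊆ dComp i 𝒢 := by
  intro X hX
  rw [mem_dComp] at hX ⊢
  rcases hX with ⟨hi, h₁, h₂⟩ | ⟨hi, h₁ | h₁⟩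
  · exact Or.inl ⟨hi, h h₁, h h₂⟩
  · exact Or.inr ⟨hi, Or.inl (h h₁)⟩
  · exact Or.inr ⟨hi, Or.inr (h h₁)⟩

theorem DComp_mono (k : ℕ) {ℱ 𝒢 : Finset (Finset ℕ)} (h : ℱ ⊆ 𝒢) : DComp k ℱ ⊆ DComp k 𝒢 := by
  induction k with
  | zero => exact h
  | succ k ih => exact dComp_mono _ ih

theorem mem_dComp_of_erase_mem {i : ℕ} {ℱ : Finset (Finset ℕ)} {X : Finset ℕ} (hX : X ∈ ℱ)
    (hXi : X.erase i ∈ ℱ) : X ∈ dComp i ℱ := by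
  rw [mem_dComp]
  tauto

/-- A subfamily of `D_j(ℱ)` that is closed under the deletion of every element of `(j, k]` is
left pointwise fixed by the compressions `d_{j+1}, …, d_k`. -/
theorem DComp_stable {ℱ : Finset (Finset ℕ)} {P : Finset ℕ → Prop} {j k : ℕ} (hjk : j ≤ k)
    (hP : ∀ C, P C → C ∈ DComp j ℱ)
    (herase : ∀ C, P C → ∀ i, j < i → i ≤ k → P (C.erase i)) :
    (∀ C, P C → C ∈ DComp k ℱ) ∧
      ∀ A, P (DCompSet j ℱ A) → DCompSet k ℱ A = DCompSet j ℱ A := by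
  induction k, hjk using Nat.le_induction with
  | base => exact ⟨hP, fun _ _ => rfl⟩
  | succ k hjk ih =>
    obtain ⟨ih₁, ih₂⟩ := ih fun C hC i hi hik => herase C hC i hi (hik.trans k.le_succ)
    have hstep : ∀ C, P C → C.erase (k + 1) ∈ DComp k ℱ := fun C hC =>
      ih₁ _ (herase C hC _ (Nat.lt_succ_of_le hjk) le_rfl)
    refine ⟨fun C hC => mem_dComp_of_erase_mem (ih₁ C hC) (hstep C hC), fun A hA => ?_⟩
    rw [DCompSet, ih₂ A hA, compressSet, if_neg fun h => h.2 (hstep _ hA)]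

theorem DComp_cube {ℱ : Finset (Finset ℕ)} {B : Finset ℕ} {b k : ℕ} (hB : RootedAt ℱ B b)
    (hk : k < b) : RootedAt (DComp k ℱ) B b ∧ DCompSet k ℱ B = B := by
  have h := DComp_stable (ℱ := ℱ) (P := fun C => {b} ⊆ C ∧ C ⊆ B) k.zero_le
    (fun C hC => hB.2 C hC.1 hC.2) fun C hC i _ hi => by
      refine ⟨?_, (erase_subset _ _).trans hC.2⟩
      rw [singleton_subset_iff, mem_erase]
      exact ⟨by lia, singleton_subset_iff.1 hC.1⟩
  exact ⟨⟨hB.1, fun C h₁ h₂ => h.1 C ⟨h₁, h₂⟩⟩,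
    h.2 B ⟨singleton_subset_iff.2 hB.1, Subset.rfl⟩⟩

theorem DComp_stable_of_subset {ℱ : Finset (Finset ℕ)} {X : Finset ℕ} {j k : ℕ} (hjk : j ≤ k)
    (hX : ∀ C ⊆ X, C ∈ DComp j ℱ) :
    (∀ C ⊆ X, C ∈ DComp k ℱ) ∧
      ∀ A, DCompSet j ℱ A ⊆ X → DCompSet k ℱ A = DCompSet j ℱ A :=
  DComp_stable hjk hX fun _ hC _ _ _ => (erase_subset _ _).trans hC

theorem RootedAt.mono {ℱ : Finset (Finset ℕ)} {X Y : Finset ℕ} {r : ℕ} (h : RootedAt ℱ Y r)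
    (hr : r ∈ X) (hXY : X ⊆ Y) : RootedAt ℱ X r :=
  ⟨hr, fun C h₁ h₂ => h.2 C h₁ (h₂.trans hXY)⟩

theorem RootedAt.mem {ℱ : Finset (Finset ℕ)} {X : Finset ℕ} {r : ℕ} (h : RootedAt ℱ X r) :
    X ∈ ℱ :=
  h.2 X (singleton_subset_iff.2 h.1) Subset.rfl

theorem RootedAt.of_erase {ℱ : Finset (Finset ℕ)} {X : Finset ℕ} {i r : ℕ} (h : RootedAt ℱ X i)
    (hr : RootedAt ℱ (X.erase i) r) : RootedAt ℱ X r := by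
  refine ⟨mem_of_mem_erase hr.1, fun C h₁ h₂ => ?_⟩
  by_cases hi : i ∈ C
  · exact h.2 C (singleton_subset_iff.2 hi) h₂
  · exact hr.2 C h₁ (subset_erase.2 ⟨h₂, hi⟩)

theorem RootedAt.forall_subset {ℱ : Finset (Finset ℕ)} {X : Finset ℕ} {i : ℕ}
    (h : RootedAt ℱ X i) (hX : ∀ C ⊆ X.erase i, C ∈ ℱ) : ∀ C ⊆ X, C ∈ ℱ := by
  intro C hC
  by_cases hi : i ∈ C
  · exact h.2 C (singleton_subset_iff.2 hi) hC
  · exact hX C (subset_erase.2 ⟨hC, hi⟩)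

theorem RootedAt.mem_dComp_of_subset_erase {ℱ : Finset (Finset ℕ)} {X C : Finset ℕ} {i : ℕ}
    (h : RootedAt ℱ X i) (hC : C ⊆ X.erase i) : C ∈ dComp i ℱ := by
  refine mem_dComp.2 (Or.inr ⟨(subset_erase.1 hC).2, Or.inr (h.2 _ ?_ ?_)⟩)
  · exact singleton_subset_iff.2 (mem_insert_self _ _)
  · exact insert_subset h.1 (subset_erase.1 hC).1

/-- Every member of `D_k(ℱ)` has all its subsets in `D_k(ℱ)`, unless it is already `ℱ`-rooted at
an element larger than `k`. -/
theorem SimplyRooted.DComp_dichotomy {ℱ : Finset (Finset ℕ)} (hsr : SimplyRooted ℱ)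
    (hpos : ∀ X ∈ ℱ, ∀ r ∈ X, 0 < r) (k : ℕ) :
    ∀ X ∈ DComp k ℱ, (∀ C ⊆ X, C ∈ DComp k ℱ) ∨ ∃ r, k < r ∧ RootedAt ℱ X r := by
  induction k with
  | zero =>
    intro X hX
    rcases X.eq_empty_or_nonempty with rfl | hne
    · exact Or.inl fun C hC => by rwa [subset_empty.1 hC]
    · obtain ⟨r, hr, hcube⟩ := hsr X hX hne
      exact Or.inr ⟨r, hpos X hX r hr, hr, hcube⟩
  | succ k ih =>
    have hdown : ∀ X : Finset ℕ, (∀ C ⊆ X, C ∈ DComp k ℱ) → ∀ C ⊆ X, C ∈ DComp (k + 1) ℱ :=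
      fun X hX => (DComp_stable_of_subset k.le_succ hX).1
    have hfixed : ∀ X ∈ DComp k ℱ, (k + 1 ∈ X → X.erase (k + 1) ∈ DComp k ℱ) →
        (∀ C ⊆ X, C ∈ DComp (k + 1) ℱ) ∨ ∃ r, k + 1 < r ∧ RootedAt ℱ X r := by
      intro X hX hXi
      obtain hall | ⟨r, hkr, hr⟩ := ih X hX
      · exact Or.inl (hdown X hall)
      obtain rfl | hne := eq_or_ne r (k + 1)
      · obtain hall | ⟨r, hkr', hr'⟩ := ih _ (hXi hr.1)
        · exact Or.inl (hdown X ((DComp_cube hr hkr).1.forall_subset hall))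
        · have := ne_of_mem_erase hr'.1
          exact Or.inr ⟨r, by lia, hr.of_erase hr'⟩
      · exact Or.inr ⟨r, by lia, hr⟩
    intro X hX
    obtain ⟨_, hX, hXi⟩ | ⟨hi, hX | hX⟩ := mem_dComp.1 hX
    · exact hfixed X hX fun _ => hXi
    · exact hfixed X hX fun h => absurd h hi
    · obtain hall | ⟨r, hkr, hr⟩ := ih _ hX
      · exact Or.inl (hdown X fun C hC => hall C (hC.trans (subset_insert _ _)))
      obtain rfl | hne := eq_or_ne r (k + 1)
      · exact Or.inl fun C hC => (DComp_cube hr hkr).1.mem_dComp_of_subset_erase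
          (by rwa [erase_insert hi])
      · exact Or.inr ⟨r, by lia, hr.mono (mem_of_mem_insert_of_ne hr.1 hne) (subset_insert _ _)⟩

theorem DCompSet_eq_erase {ℱ : Finset (Finset ℕ)} {B : Finset ℕ} {k n : ℕ} (hkn : k + 1 ≤ n)
    (hB : RootedAt ℱ B (k + 1)) (hmem : B.erase (k + 1) ∉ DComp k ℱ) :
    DCompSet n ℱ B = B.erase (k + 1) := by
  obtain ⟨hcube, hfix⟩ := DComp_cube hB k.lt_succ_self
  have hstep : DCompSet (k + 1) ℱ B = B.erase (k + 1) := by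
    rw [DCompSet, hfix, compressSet, if_pos ⟨hB.1, hmem⟩]
  rw [← hstep]
  exact (DComp_stable_of_subset hkn fun C hC => hcube.mem_dComp_of_subset_erase hC).2 B
    hstep.subset

/-- Let `ℬ' ⊆ ℬ ⊆ 𝒫(n)` be simply rooted families and let
`B ∈ ℬ'` be a good set of `ℬ`. Then `d_ℬ(B) = d_{ℬ'}(B)`. -/
theorem stmt15 (n : ℕ) (ℬ' ℬ : Finset (Finset ℕ)) (hsub' : ℬ' ⊆ ℬ)
    (hsub : ℬ ⊆ (Finset.Icc 1 n).powerset)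
    (hsr' : SimplyRooted ℬ') (hsr : SimplyRooted ℬ)
    (B : Finset ℕ) (hBmem : B ∈ ℬ') (hgood : ¬ BadSet n ℬ B) :
    DCompSet n ℬ B = DCompSet n ℬ' B := by
  obtain ⟨hshadow, hmove⟩ := not_or.1 hgood
  have hIcc : ∀ X ∈ ℬ, ∀ r ∈ X, 1 ≤ r ∧ r ≤ n := fun X hX r hr =>
    mem_Icc.1 (mem_powerset.1 (hsub hX) hr)
  have hne : B.Nonempty := by
    rw [nonempty_iff_ne_empty]
    rintro rfl
    exact hshadow (by simp [shadowSet])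
  obtain ⟨b, hb, hcube⟩ := hsr' B hBmem hne
  have hroot' : RootedAt ℬ' B b := ⟨hb, hcube⟩
  have hroot : RootedAt ℬ B b := ⟨hb, fun C h₁ h₂ => hsub' (hcube C h₁ h₂)⟩
  obtain ⟨hb₁, hbn⟩ := hIcc B hroot.mem b hb
  obtain ⟨k, rfl⟩ := Nat.exists_eq_add_of_le' hb₁
  have herase : B.erase (k + 1) ∉ ℬ := by
    intro h
    refine hshadow fun C hC => ?_
    obtain ⟨i, _, rfl⟩ := mem_image.1 hC
    obtain rfl | hi := eq_or_ne i (k + 1)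
    · exact h
    · exact hroot.2 _ (singleton_subset_iff.2 (mem_erase.2 ⟨hi.symm, hb⟩)) (erase_subset _ _)
  have hk : B.erase (k + 1) ∉ DComp k ℬ := by
    intro h
    obtain hall | ⟨r, _, hr⟩ := hsr.DComp_dichotomy (fun X hX r hr => (hIcc X hX r hr).1) k _ h
    · obtain ⟨hcube', hfix⟩ := DComp_cube hroot k.lt_succ_self
      refine hmove (Eq.trans ?_ hfix)
      exact (DComp_stable_of_subset (by lia) (hcube'.forall_subset hall)).2 B hfix.subset
    · exact herase hr.mem
  rw [DCompSet_eq_erase hbn hroot hk,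
    DCompSet_eq_erase hbn hroot' fun h => hk (DComp_mono k hsub' h)]
end
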